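/- arXiv:1911.08643 — 3 statements merged into one kernel-verified Lean document; each statement's English description precedes it below -/
import Mathlib

section
/- Let L(x,t,a) = ∫_ℝ e^{-(1+i)t|ξ|^a} e^{ixξ} dξ be the convolution kernel of the operator e^{-(1+i)t(-Δ)^{a/2}}. Then for all a > 0, x ∈ ℝ, t > 0, one has |L(x,t,a)| ≲ t / (t^{2/a} + |x|²)^{(1+a)/2}. -/
open MeasureTheory

/-- The convolution kernel of `e^{-(1+i)t(-Δ)^{a/2}}`. -/
noncomputable def kernelL (x t a : ℝ) : ℂ :=
  ∫ ξ : ℝ, Complex.exp (-(1 + Complex.I) * ((t * |ξ| ^ a : ℝ) : ℂ)) *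
    Complex.exp (Complex.I * ((x * ξ : ℝ) : ℂ))

open Set Filter Topology

lemma aux_exp_sub_one {z : ℂ} (hz : 0 ≤ z.re) : ‖Complex.exp (-z) - 1‖ ≤ ‖z‖ := by
  have h := Convex.norm_image_sub_le_of_norm_hasDerivWithin_le (𝕜 := ℂ)
    (f := fun w : ℂ => Complex.exp (-w)) (f' := fun w => Complex.exp (-w) * (-1))
    (s := {w : ℂ | 0 ≤ w.re}) (x := 0) (y := z) (C := 1)
    (fun w _ => ((hasDerivAt_neg w).cexp).hasDerivWithinAt)
    (fun w hw => by
      have hw' : 0 ≤ w.re := hw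
      simp [Complex.norm_exp, hw'])
    (convex_halfSpace_re_ge 0) (by simp) hz
  simpa using h

lemma aux_integral_exp (f : ℝ → ℂ) :
    ∫ u : ℝ, Real.exp u • f (Real.exp u) = ∫ s in Ioi (0 : ℝ), f s := by
  rw [← Real.range_exp, ← image_univ]
  simpa [abs_of_pos (Real.exp_pos _)] using (integral_image_eq_integral_abs_deriv_smul
      MeasurableSet.univ (fun x _ ↦ (Real.hasDerivAt_exp x).hasDerivWithinAt)
      (fun x _ y _ hxy ↦ Real.exp_injective hxy) f).symm

lemma aux_integrable_exp (f : ℝ → ℝ) :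
    Integrable (fun u : ℝ => Real.exp u • f (Real.exp u)) ↔ IntegrableOn f (Ioi (0 : ℝ)) := by
  rw [← Real.range_exp, ← image_univ]
  simpa [abs_of_pos (Real.exp_pos _)] using (integrableOn_image_iff_integrableOn_abs_deriv_smul
      MeasurableSet.univ (fun x _ ↦ (Real.hasDerivAt_exp x).hasDerivWithinAt)
      (fun x _ y _ hxy ↦ Real.exp_injective hxy) f).symm

lemma aux_shift (g : ℂ → ℂ) (hg : Differentiable ℂ g) (M : ℝ → ℝ) (θ : ℝ)
    (hM : ∀ u v : ℝ, v ∈ uIcc 0 θ → ‖g (u + v * Complex.I)‖ ≤ M u)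
    (hi : Integrable M) (h1 : Tendsto M atTop (𝓝 0)) (h2 : Tendsto M atBot (𝓝 0)) :
    ∫ u : ℝ, g u = ∫ u : ℝ, g (u + θ * Complex.I) := by
  have hc := hg.continuous
  have i0 : Integrable (fun u : ℝ => g u) := by
    refine hi.mono' (by fun_prop) (ae_of_all _ fun u => ?_)
    simpa using hM u 0 (by simp)
  have i1 : Integrable (fun u : ℝ => g (u + θ * Complex.I)) :=
    hi.mono' (by fun_prop) (ae_of_all _ fun u => hM u θ (by simp))
  have t0 := intervalIntegral_tendsto_integral i0 tendsto_neg_atTop_atBot tendsto_id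
  have t1 := intervalIntegral_tendsto_integral i1 tendsto_neg_atTop_atBot tendsto_id
  have v : ∀ (l : Filter ℝ) , Tendsto M l (𝓝 0) →
      Tendsto (fun R : ℝ => ∫ y in (0:ℝ)..θ, g (R + y * Complex.I)) l (𝓝 0) := by
    intro l hl
    refine squeeze_zero_norm (a := fun R => M R * |θ - 0|) (fun R => ?_) (by simpa using hl.mul_const |θ - 0|)
    exact intervalIntegral.norm_integral_le_of_norm_le_const fun y hy =>
      hM R y (uIoc_subset_uIcc hy)
  have v1 := v _ h1
  have v2 := (v _ h2).comp tendsto_neg_atTop_atBot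
  have key := ((t0.sub t1).add (v1.const_smul Complex.I)).sub (v2.const_smul Complex.I)
  have : (fun _ : ℝ => (0:ℂ)) = _ := funext fun R : ℝ =>
    (Complex.integral_boundary_rect_eq_zero_of_differentiableOn g (-R : ℝ) (R + θ * Complex.I)
      hg.differentiableOn).symm
  have k2 := tendsto_nhds_unique (f := fun _ : ℝ => (0:ℂ)) (tendsto_const_nhds) (by
    rw [this]; simpa using key)
  exact (sub_eq_zero.1 k2.symm)

lemma aux_M (a t : ℝ) (ha : 0 < a) (ht : 0 < t) :
    Integrable (fun u : ℝ => Real.exp u * Real.exp (-t * Real.exp u ^ a)) ∧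
    Tendsto (fun u : ℝ => Real.exp u * Real.exp (-t * Real.exp u ^ a)) atTop (𝓝 0) ∧
    Tendsto (fun u : ℝ => Real.exp u * Real.exp (-t * Real.exp u ^ a)) atBot (𝓝 0) := by
  refine ⟨?_, ?_, ?_⟩
  · refine (aux_integrable_exp (fun s => Real.exp (-t * s ^ a))).2 ?_
    simpa using integrableOn_rpow_mul_exp_neg_mul_rpow (s := 0) (by norm_num) ha ht
  · have h := (tendsto_rpow_mul_exp_neg_mul_atTop_nhds_zero (1/a) t ht).comp
      ((tendsto_rpow_atTop ha).comp Real.tendsto_exp_atTop)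
    refine h.congr fun u => ?_
    simp only [Function.comp]
    rw [← Real.rpow_mul (Real.exp_pos u).le, mul_one_div_cancel ha.ne', Real.rpow_one]
  · refine squeeze_zero (fun u => by positivity) (fun u => ?_) Real.tendsto_exp_atBot
    refine mul_le_of_le_one_right (by positivity) ?_
    rw [Real.exp_le_one_iff]
    have : 0 ≤ t * Real.exp u ^ a := by positivity
    linarith

noncomputable def auxJ (x t a : ℝ) : ℂ :=
  ∫ s in Ioi (0:ℝ), Complex.exp (-(1 + Complex.I) * ((t * s ^ a : ℝ) : ℂ)) *
    Complex.exp (Complex.I * ((x * s : ℝ) : ℂ))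

lemma aux_re (φ : ℝ) : ((1 + Complex.I) * Complex.exp (φ * Complex.I)).re
    = Real.cos φ - Real.sin φ := by
  rw [Complex.exp_mul_I, ← Complex.ofReal_cos, ← Complex.ofReal_sin]
  simp [Complex.cos_ofReal_re, Complex.sin_ofReal_re]

lemma aux_cs (φ : ℝ) (h : |φ| ≤ 1/4) : 1/2 ≤ Real.cos φ - Real.sin φ := by
  have h1 := Real.one_sub_sq_div_two_le_cos (x := φ)
  have h2 := (le_abs_self _).trans (Real.abs_sin_le_abs (x := φ))
  have h3 : φ^2 ≤ (1/4)^2 := sq_le_sq' (by linarith [neg_abs_le φ]) (by linarith [le_abs_self φ])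
  linarith

lemma aux_rot (a t x θ : ℝ) (ha : 0 < a) (ht : 0 < t) (hθ : |θ| ≤ 1) (haθ : a * |θ| ≤ 1/4)
    (hx : 0 ≤ x * θ) :
    auxJ x t a = ∫ s in Ioi (0:ℝ), Complex.exp (θ * Complex.I) *
      (Complex.exp (-((1 + Complex.I) * Complex.exp ((a * θ : ℝ) * Complex.I)
          * ((t * s ^ a : ℝ) : ℂ))) *
       Complex.exp ((Complex.I * x * Complex.exp (θ * Complex.I)) * s)) := by
  obtain ⟨m1, m2, m3⟩ := aux_M a (t/2) ha (by positivity)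
  let g : ℂ → ℂ := fun w => Complex.exp w * (Complex.exp (-((1 + Complex.I) * t * Complex.exp (a * w))) *
    Complex.exp (Complex.I * x * Complex.exp w))
  have hgd : Differentiable ℂ g := by fun_prop
  have hexp : ∀ u : ℝ, ((Real.exp u ^ a : ℝ) : ℂ) = Complex.exp (a * u) := fun u => by
    rw [← Real.exp_mul]; push_cast; rw [mul_comm]
  have hpt : ∀ u v : ℝ, g (u + v * Complex.I) = Real.exp u • (Complex.exp (v * Complex.I) *
      (Complex.exp (-((1 + Complex.I) * Complex.exp ((a * v : ℝ) * Complex.I)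
          * ((t * Real.exp u ^ a : ℝ) : ℂ))) *
       Complex.exp ((Complex.I * x * Complex.exp (v * Complex.I)) * (Real.exp u : ℝ)))) := by
    intro u v
    have e1 : Complex.exp (u + v * Complex.I) = Complex.exp u * Complex.exp (v * Complex.I) :=
      Complex.exp_add _ _
    have e2 : Complex.exp (a * (u + v * Complex.I)) =
        Complex.exp (a * u) * Complex.exp ((a * v : ℝ) * Complex.I) := by
      rw [← Complex.exp_add]; congr 1; push_cast; ring
    simp only [g]
    rw [e2, e1, Complex.ofReal_mul t, hexp, Complex.real_smul, Complex.ofReal_exp, mul_assoc (Complex.exp (u:ℂ))]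
    congr 2
    congr 2 <;> ring
  have hbd : ∀ u v : ℝ, v ∈ uIcc 0 θ → ‖g (u + v * Complex.I)‖ ≤
      Real.exp u * Real.exp (-(t/2) * Real.exp u ^ a) := by
    intro u v hv
    have hvθ : |v| ≤ |θ| := by simpa using abs_sub_left_of_mem_uIcc hv
    have hxv : 0 ≤ x * Real.sin v := by
      have hs : 0 ≤ v → 0 ≤ Real.sin v := fun h => Real.sin_nonneg_of_nonneg_of_le_pi h
        (by linarith [le_abs_self v, Real.pi_gt_three])
      have hs' : v ≤ 0 → Real.sin v ≤ 0 := fun h => Real.sin_nonpos_of_nonpos_of_neg_pi_le h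
        (by linarith [neg_abs_le v, Real.pi_gt_three])
      rcases mem_uIcc.1 hv with ⟨h0, h1⟩ | ⟨h0, h1⟩
      · rcases eq_or_lt_of_le h0 with h | h
        · simp [← h]
        · exact mul_nonneg (nonneg_of_mul_nonneg_left hx (h.trans_le h1)) (hs h0)
      · rcases eq_or_lt_of_le h1 with h | h
        · simp [h]
        · refine mul_nonneg_of_nonpos_of_nonpos ?_ (hs' h1)
          by_contra! hc
          nlinarith
    rw [hpt, norm_smul, Real.norm_of_nonneg (Real.exp_pos u).le]
    refine mul_le_mul_of_nonneg_left ?_ (Real.exp_pos u).le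
    rw [norm_mul, Complex.norm_exp_ofReal_mul_I, one_mul, ← Complex.exp_add, Complex.norm_exp]
    rw [Real.exp_le_exp, Complex.add_re, Complex.neg_re, Complex.re_mul_ofReal, Complex.re_mul_ofReal, aux_re]
    have r2 : (Complex.I * x * Complex.exp (v * Complex.I)).re = - (x * Real.sin v) := by
      rw [Complex.exp_mul_I, ← Complex.ofReal_cos, ← Complex.ofReal_sin]
      simp [Complex.cos_ofReal_re, Complex.sin_ofReal_re]
    rw [r2]
    have hc := aux_cs (a * v) (by
      rw [abs_mul, abs_of_pos ha]; exact (mul_le_mul_of_nonneg_left hvθ ha.le).trans haθ)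
    have hp : 0 ≤ t * Real.exp u ^ a := by positivity
    have := mul_le_mul_of_nonneg_right hc hp
    have := mul_nonneg hxv (Real.exp_pos u).le
    linarith
  have hs := aux_shift g hgd _ θ hbd m1 m2 m3
  rw [← aux_integral_exp]
  simp_rw [← hpt]
  rw [← hs, auxJ, ← aux_integral_exp]
  refine integral_congr_ae (ae_of_all _ fun u => ?_)
  have := hpt u 0
  simp only [Complex.ofReal_zero, zero_mul, add_zero, mul_zero, Complex.exp_zero, one_mul, mul_one] at this
  simp only [this]
  congr 3
  · ring_nf
  · push_cast; ring_nf

lemma aux_Jbound (a t x θ : ℝ) (ha : 0 < a) (ht : 0 < t) (hθ : |θ| ≤ 1) (haθ : a * |θ| ≤ 1/4)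
    (hx : 0 < x * θ) :
    ‖auxJ x t a - Complex.I / x‖ ≤
      2 * t * ((1 / (|x| * Real.sin |θ|)) ^ (a + 1) * Real.Gamma (a + 1)) := by
  have hx0 : x ≠ 0 := by rintro rfl; simp at hx
  have hθ0 : θ ≠ 0 := by rintro rfl; simp at hx
  have hsin : 0 < Real.sin |θ| := Real.sin_pos_of_pos_of_lt_pi (abs_pos.2 hθ0)
    (by linarith [Real.pi_gt_three])
  have hr : 0 < |x| * Real.sin |θ| := mul_pos (abs_pos.2 hx0) hsin
  have hxs : x * Real.sin θ = |x| * Real.sin |θ| := by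
    rcases pos_and_pos_or_neg_and_neg_of_mul_pos hx with ⟨h1, h2⟩ | ⟨h1, h2⟩
    · rw [abs_of_pos h1, abs_of_pos h2]
    · rw [abs_of_neg h1, abs_of_neg h2, Real.sin_neg]; ring
  set b : ℂ := Complex.I * x * Complex.exp (θ * Complex.I) with hb
  have hbre : b.re = - (|x| * Real.sin |θ|) := by
    rw [hb, Complex.exp_mul_I, ← Complex.ofReal_cos, ← Complex.ofReal_sin, ← hxs]
    simp [Complex.cos_ofReal_re, Complex.sin_ofReal_re]
  have hbneg : b.re < 0 := by rw [hbre]; linarith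
  have hI : Complex.I / x = ∫ s in Ioi (0:ℝ), Complex.exp (θ * Complex.I) * Complex.exp (b * s) := by
    rw [integral_const_mul, integral_exp_mul_complex_Ioi hbneg, hb]
    have := Complex.exp_ne_zero (θ * Complex.I)
    have hxc : (x:ℂ) ≠ 0 := by exact_mod_cast hx0
    have := Complex.I_ne_zero
    field_simp
    simp
  have hzre : 0 ≤ ((1 + Complex.I) * Complex.exp ((a * θ : ℝ) * Complex.I)).re := by
    rw [aux_re]
    have := aux_cs (a * θ) (by rw [abs_mul, abs_of_pos ha]; exact haθ)
    linarith
  have hzn : ‖(1 + Complex.I) * Complex.exp ((a * θ : ℝ) * Complex.I)‖ ≤ 2 := by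
    rw [norm_mul, Complex.norm_exp_ofReal_mul_I, mul_one]
    refine (norm_add_le _ _).trans ?_
    simp; norm_num
  set z : ℂ := (1 + Complex.I) * Complex.exp ((a * θ : ℝ) * Complex.I) with hz
  have hib := integrableOn_exp_mul_complex_Ioi hbneg 0
  have i2 : IntegrableOn (fun s : ℝ => Complex.exp (θ * Complex.I) * Complex.exp (b * s)) (Ioi 0) :=
    hib.const_mul _
  have i1 : IntegrableOn (fun s : ℝ => Complex.exp (θ * Complex.I) *
      (Complex.exp (-(z * ((t * s ^ a : ℝ) : ℂ))) * Complex.exp (b * s))) (Ioi 0) := by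
    refine Integrable.const_mul ?_ _
    refine hib.bdd_mul (c := 1) ?_ ?_
    · refine ContinuousOn.aestronglyMeasurable ?_ measurableSet_Ioi
      refine ContinuousOn.cexp (ContinuousOn.neg (continuousOn_const.mul
        (Complex.continuous_ofReal.comp_continuousOn (continuousOn_const.mul
          (continuousOn_id.rpow_const fun _ _ => Or.inr ha.le)))))
    · filter_upwards [ae_restrict_mem measurableSet_Ioi] with s hs
      have hs' : (0:ℝ) < s := hs
      rw [Complex.norm_exp, Real.exp_le_one_iff, Complex.neg_re, Complex.re_mul_ofReal]
      have : 0 ≤ t * s ^ a := by positivity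
      nlinarith
  rw [aux_rot a t x θ ha ht hθ haθ hx.le, hI, ← integral_sub i1 i2]
  have hg := Real.integral_rpow_mul_exp_neg_mul_Ioi (a := a + 1) (r := |x| * Real.sin |θ|)
    (by positivity) hr
  have hgi : IntegrableOn (fun s : ℝ => s ^ (a + 1 - 1) * Real.exp (-((|x| * Real.sin |θ|) * s))) (Ioi 0) := by
    have := integrableOn_rpow_mul_exp_neg_mul_rpow (s := a + 1 - 1) (p := 1) (b := |x| * Real.sin |θ|)
      (by linarith) one_pos hr
    simpa using this
  rw [← hg, ← integral_const_mul]
  refine norm_integral_le_of_norm_le (hgi.const_mul _) ?_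
  filter_upwards [ae_restrict_mem measurableSet_Ioi] with s hs
  have hs' : (0:ℝ) < s := hs
  have hp : 0 ≤ t * s ^ a := by positivity
  have e : Complex.exp (θ * Complex.I) *
      (Complex.exp (-(z * ((t * s ^ a : ℝ) : ℂ))) * Complex.exp (b * s)) -
      Complex.exp (θ * Complex.I) * Complex.exp (b * s) =
      Complex.exp (θ * Complex.I) * ((Complex.exp (-(z * ((t * s ^ a : ℝ) : ℂ))) - 1) *
        Complex.exp (b * s)) := by ring
  rw [e, norm_mul, Complex.norm_exp_ofReal_mul_I, one_mul, norm_mul, Complex.norm_exp (b * s),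
    Complex.re_mul_ofReal, hbre, add_sub_cancel_right, ← mul_assoc, neg_mul]
  refine mul_le_mul_of_nonneg_right ?_ (Real.exp_pos _).le
  refine (aux_exp_sub_one ?_).trans ?_
  · rw [Complex.re_mul_ofReal]; positivity
  · rw [norm_mul, Complex.norm_real, Real.norm_of_nonneg hp, mul_assoc]
    exact mul_le_mul_of_nonneg_right hzn hp

lemma aux_norm (x t a ξ : ℝ) : ‖Complex.exp (-(1 + Complex.I) * ((t * |ξ| ^ a : ℝ) : ℂ)) *
    Complex.exp (Complex.I * ((x * ξ : ℝ) : ℂ))‖ = Real.exp (-t * |ξ| ^ a) := by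
  rw [norm_mul, mul_comm Complex.I, Complex.norm_exp_ofReal_mul_I, mul_one, Complex.norm_exp,
    Complex.re_mul_ofReal]
  simp

lemma aux_int (x t a : ℝ) (ha : 0 < a) (ht : 0 < t) :
    IntegrableOn (fun ξ : ℝ => Complex.exp (-(1 + Complex.I) * ((t * |ξ| ^ a : ℝ) : ℂ)) *
    Complex.exp (Complex.I * ((x * ξ : ℝ) : ℂ))) (Ioi 0) := by
  have h := integrableOn_rpow_mul_exp_neg_mul_rpow (s := 0) (by norm_num) ha ht
  simp only [Real.rpow_zero, one_mul] at h
  have hc : Continuous fun ξ : ℝ => |ξ| ^ a := continuous_abs.rpow_const fun _ => Or.inr ha.le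
  refine Integrable.mono' h (by fun_prop) ?_
  filter_upwards [ae_restrict_mem measurableSet_Ioi] with s hs
  rw [aux_norm, abs_of_pos hs]

lemma aux_Iic (x t a : ℝ) :
    ∫ ξ in Iic (0:ℝ), Complex.exp (-(1 + Complex.I) * ((t * |ξ| ^ a : ℝ) : ℂ)) *
      Complex.exp (Complex.I * ((x * ξ : ℝ) : ℂ)) = auxJ (-x) t a := by
  have := integral_comp_neg_Ioi (0:ℝ) (fun ξ : ℝ => Complex.exp (-(1 + Complex.I) * ((t * |ξ| ^ a : ℝ) : ℂ)) *
      Complex.exp (Complex.I * ((x * ξ : ℝ) : ℂ)))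
  rw [neg_zero] at this
  rw [← this, auxJ]
  refine setIntegral_congr_fun measurableSet_Ioi fun s hs => ?_
  simp only [abs_neg, abs_of_pos (show (0:ℝ) < s from hs), mul_neg, neg_mul]

lemma aux_Ioi (x t a : ℝ) :
    ∫ ξ in Ioi (0:ℝ), Complex.exp (-(1 + Complex.I) * ((t * |ξ| ^ a : ℝ) : ℂ)) *
      Complex.exp (Complex.I * ((x * ξ : ℝ) : ℂ)) = auxJ x t a := by
  refine setIntegral_congr_fun measurableSet_Ioi fun s hs => ?_
  simp only [abs_of_pos (show (0:ℝ) < s from hs)]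

lemma aux_split (x t a : ℝ) (ha : 0 < a) (ht : 0 < t) :
    kernelL x t a = auxJ x t a + auxJ (-x) t a := by
  have i1 := aux_int x t a ha ht
  have i2 : IntegrableOn (fun ξ : ℝ => Complex.exp (-(1 + Complex.I) * ((t * |ξ| ^ a : ℝ) : ℂ)) *
      Complex.exp (Complex.I * ((x * ξ : ℝ) : ℂ))) (Iic 0) := by
    have h := aux_int (-x) t a ha ht
    rw [← neg_zero] at h
    have := h.comp_neg_Iio
    rw [integrableOn_Iic_iff_integrableOn_Iio]
    simpa using this
  rw [kernelL, ← aux_Iic, ← aux_Ioi]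
  have := setIntegral_union (Set.Iic_disjoint_Ioi (le_refl (0:ℝ))).symm measurableSet_Iic i1 i2
  rw [← this, union_comm, Iic_union_Ioi, Measure.restrict_univ]

lemma aux_triv (x t a : ℝ) (ha : 0 < a) (ht : 0 < t) :
    ‖kernelL x t a‖ ≤ 2 * Real.Gamma (1 / a + 1) * t ^ (-1 / a) := by
  rw [kernelL]
  refine (norm_integral_le_integral_norm _).trans ?_
  simp_rw [aux_norm]
  rw [integral_comp_abs (f := fun s => Real.exp (-t * s ^ a)), integral_exp_neg_mul_rpow ha ht]
  apply le_of_eq; ring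

theorem kernelL_bound (a : ℝ) (ha : 0 < a) :
    ∃ C : ℝ, 0 < C ∧ ∀ x t : ℝ, 0 < t →
      ‖kernelL x t a‖ ≤ C * t / (t ^ (2 / a) + |x| ^ 2) ^ ((1 + a) / 2) := by
  set θ : ℝ := min 1 (1 / (4 * a)) with hθ
  have hθ0 : 0 < θ := by positivity
  have hθ1 : θ ≤ 1 := min_le_left _ _
  have haθ : a * θ ≤ 1/4 := by
    have : θ ≤ 1 / (4 * a) := min_le_right _ _
    calc a * θ ≤ a * (1 / (4 * a)) := by gcongr
      _ = 1/4 := by field_simp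
  have hsin : 0 < Real.sin θ := Real.sin_pos_of_pos_of_lt_pi hθ0 (by linarith [Real.pi_gt_three])
  have hG1 : 0 < Real.Gamma (1 / a + 1) := Real.Gamma_pos_of_pos (by positivity)
  have hG2 : 0 < Real.Gamma (a + 1) := Real.Gamma_pos_of_pos (by positivity)
  set C1 : ℝ := 2 * Real.Gamma (1 / a + 1) with hC1
  set C2 : ℝ := 4 * ((1 / Real.sin θ) ^ (a + 1) * Real.Gamma (a + 1)) with hC2
  have hC1p : 0 < C1 := by positivity
  have hC2p : 0 < C2 := by positivity
  have htwo : ∀ r : ℝ, 0 < r → ∀ D : ℝ, 0 ≤ D → D ≤ 2 * r ^ 2 →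
      D ^ ((1 + a) / 2) ≤ 2 ^ ((1 + a) / 2) * r ^ (1 + a) := by
    intro r hr D hD h
    calc D ^ ((1 + a) / 2) ≤ (2 * r ^ 2) ^ ((1 + a) / 2) :=
          Real.rpow_le_rpow hD h (by positivity)
      _ = 2 ^ ((1 + a) / 2) * r ^ (1 + a) := by
          rw [Real.mul_rpow (by norm_num) (by positivity), ← Real.rpow_natCast r 2,
            ← Real.rpow_mul hr.le]
          congr 2; push_cast; ring
  refine ⟨(C1 + C2) * 2 ^ ((1 + a) / 2), by positivity, fun x t ht => ?_⟩
  have hD : 0 < t ^ (2 / a) + |x| ^ 2 := by positivity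
  have hDp : 0 < (t ^ (2 / a) + |x| ^ 2) ^ ((1 + a) / 2) := by positivity
  have htsq : t ^ (2 / a) = (t ^ (1 / a)) ^ 2 := by
    rw [← Real.rpow_natCast, ← Real.rpow_mul ht.le]; congr 1; push_cast; ring
  have hta : 0 < t ^ (1 / a) := by positivity
  have h2p : (0:ℝ) < 2 ^ ((1 + a) / 2) := by positivity
  rw [le_div_iff₀ hDp]
  rcases le_total |x| (t ^ (1 / a)) with hx | hx
  · have h1 := aux_triv x t a ha ht
    have h2 := htwo _ hta _ hD.le (by
      rw [htsq]; have := pow_le_pow_left₀ (abs_nonneg x) hx 2; linarith)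
    have h3 : t ^ (-1 / a) * (t ^ (1 / a)) ^ (1 + a) = t := by
      rw [← Real.rpow_mul ht.le, ← Real.rpow_add ht]
      have : -1 / a + 1 / a * (1 + a) = 1 := by field_simp; ring
      rw [this, Real.rpow_one]
    calc _ ≤ (C1 * t ^ (-1 / a)) * (2 ^ ((1 + a) / 2) * (t ^ (1 / a)) ^ (1 + a)) :=
          mul_le_mul h1 h2 hDp.le (by positivity)
      _ = C1 * 2 ^ ((1 + a) / 2) * (t ^ (-1 / a) * (t ^ (1 / a)) ^ (1 + a)) := by ring
      _ = C1 * 2 ^ ((1 + a) / 2) * t := by rw [h3]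
      _ ≤ _ := by gcongr; linarith
  · have hxp : 0 < |x| := hta.trans_le hx
    have hx0 : x ≠ 0 := abs_pos.1 hxp
    have h2 := htwo _ hxp _ hD.le (by
      rw [htsq]; have := pow_le_pow_left₀ hta.le hx 2; linarith)
    have hJ : ∀ y : ℝ, |y| = |x| → ‖auxJ y t a - Complex.I / y‖ ≤
        2 * t * ((1 / (|x| * Real.sin θ)) ^ (a + 1) * Real.Gamma (a + 1)) := by
      intro y hy
      rcases lt_or_gt_of_ne (abs_pos.1 (hy ▸ hxp)) with h | h
      · have := aux_Jbound a t y (-θ) ha ht (by rwa [abs_neg, abs_of_pos hθ0])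
          (by rwa [abs_neg, abs_of_pos hθ0]) (by nlinarith)
        rwa [abs_neg, abs_of_pos hθ0, hy] at this
      · have := aux_Jbound a t y θ ha ht (by rwa [abs_of_pos hθ0])
          (by rwa [abs_of_pos hθ0]) (by positivity)
        rwa [abs_of_pos hθ0, hy] at this
    have h1 : ‖kernelL x t a‖ ≤ C2 * t * |x| ^ (-(1 + a)) := by
      have e : kernelL x t a = (auxJ x t a - Complex.I / x) +
          (auxJ (-x) t a - Complex.I / ((-x : ℝ) : ℂ)) := by
        rw [aux_split x t a ha ht]; push_cast; rw [div_neg]; ring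
      rw [e]
      refine (norm_add_le _ _).trans ((add_le_add (hJ x rfl) (hJ (-x) (abs_neg x))).trans ?_)
      have : (1 / (|x| * Real.sin θ)) ^ (a + 1) = |x| ^ (-(1 + a)) * (1 / Real.sin θ) ^ (a + 1) := by
        rw [Real.rpow_neg hxp.le, ← Real.inv_rpow hxp.le, add_comm 1 a,
          ← Real.mul_rpow (by positivity) (by positivity)]
        congr 1; field_simp
      rw [this]
      apply le_of_eq; ring
    have h3 : |x| ^ (-(1 + a)) * |x| ^ (1 + a) = 1 := by
      rw [← Real.rpow_add hxp]; simp
    calc _ ≤ (C2 * t * |x| ^ (-(1 + a))) * (2 ^ ((1 + a) / 2) * |x| ^ (1 + a)) :=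
          mul_le_mul h1 h2 hDp.le (by positivity)
      _ = C2 * 2 ^ ((1 + a) / 2) * t * (|x| ^ (-(1 + a)) * |x| ^ (1 + a)) := by ring
      _ = C2 * 2 ^ ((1 + a) / 2) * t := by rw [h3, mul_one]
      _ ≤ _ := by gcongr; linarith
end

section
/- For every a > 0 there is a constant C such that for all x ∈ ℝ, |∫_ℝ e^{-(1+i)|ξ|^a} e^{ixξ} dξ| ≤ C · min(1, |x|^{-1-a}). -/
open MeasureTheory

noncomputable def oscG (a x : ℝ) (w : ℂ) : ℂ :=
  Complex.exp w * Complex.exp (-(1 + Complex.I) * Complex.exp (a * w)) *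
    Complex.exp (Complex.I * (x * Complex.exp w))

noncomputable def oscF (a x θ r : ℝ) : ℂ :=
  Complex.exp (θ * Complex.I) *
    Complex.exp (-(1 + Complex.I) * (Complex.exp ((a * θ : ℝ) * Complex.I) * ((r ^ a : ℝ) : ℂ))) *
    Complex.exp (Complex.I * (x * (Complex.exp (θ * Complex.I) * r)))

lemma oscG_eq (a x θ t : ℝ) :
    oscG a x (t + θ * Complex.I) = |Real.exp t| • oscF a x θ (Real.exp t) := by
  have h1 : ((Real.exp t ^ a : ℝ) : ℂ) = Complex.exp (a * t) := by
    rw [← Real.exp_mul]; push_cast; ring_nf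
  rw [abs_of_pos (Real.exp_pos t), Complex.real_smul, oscG, oscF, h1, mul_add, Complex.exp_add,
    Complex.exp_add]
  push_cast
  ring_nf

lemma re_phase (u : ℝ) (s : ℝ) :
    (-(1 + Complex.I) * (Complex.exp ((u : ℝ) * Complex.I) * (s : ℂ))).re
      = -(s * (Real.cos u - Real.sin u)) := by
  rw [Complex.exp_mul_I, ← Complex.ofReal_cos, ← Complex.ofReal_sin]
  simp [-Complex.ofReal_cos, -Complex.ofReal_sin]
  ring

lemma re_phase2 (x θ s : ℝ) :
    (Complex.I * (x * (Complex.exp (θ * Complex.I) * s))).re = -(x * Real.sin θ * s) := by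
  rw [Complex.exp_mul_I, ← Complex.ofReal_cos, ← Complex.ofReal_sin]
  simp [-Complex.ofReal_cos, -Complex.ofReal_sin]
  ring

lemma cos_sub_sin_ge (u : ℝ) (hu : |u| ≤ 1 / 2) : 3 / 8 ≤ Real.cos u - Real.sin u := by
  have h1 := Real.one_sub_sq_div_two_le_cos (x := u)
  have h2 := (le_abs_self _).trans (Real.abs_sin_le_abs (x := u))
  have h3 : u ^ 2 ≤ 1 / 4 := by
    rw [← sq_abs]; nlinarith [abs_nonneg u]
  linarith

lemma oscF_norm_le (a x θ r : ℝ) (hr : 0 ≤ r) (h1 : |a * θ| ≤ 1 / 2) (h2 : 0 ≤ x * Real.sin θ) :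
    ‖oscF a x θ r‖ ≤ Real.exp (-(3 / 8) * r ^ a) := by
  rw [oscF, norm_mul, norm_mul, Complex.norm_exp_ofReal_mul_I, Complex.norm_exp, Complex.norm_exp,
    re_phase, re_phase2, one_mul, ← Real.exp_add, Real.exp_le_exp]
  have := cos_sub_sin_ge _ h1
  have h3 := Real.rpow_nonneg hr a
  nlinarith [mul_nonneg h2 hr]

lemma oscG_norm_le (a x θ t : ℝ) (h1 : |a * θ| ≤ 1 / 2) (h2 : 0 ≤ x * Real.sin θ) :
    ‖oscG a x (t + θ * Complex.I)‖ ≤ Real.exp t * Real.exp (-(3 / 8) * (Real.exp t) ^ a) := by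
  rw [oscG_eq, norm_smul, Real.norm_eq_abs, abs_abs, abs_of_pos (Real.exp_pos t)]
  gcongr
  exact oscF_norm_le _ _ _ _ (Real.exp_pos t).le h1 h2

lemma oscF_integrable (a x θ : ℝ) (ha : 0 < a) (h1 : |a * θ| ≤ 1 / 2)
    (h2 : 0 ≤ x * Real.sin θ) : IntegrableOn (oscF a x θ) (Set.Ioi 0) := by
  have h := integrableOn_rpow_mul_exp_neg_mul_rpow (p := a) (s := 0) (b := 3 / 8)
    (by norm_num) ha (by norm_num)
  refine Integrable.mono' h ?_ ?_
  · apply Measurable.aestronglyMeasurable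
    unfold oscF
    fun_prop
  · filter_upwards [ae_restrict_mem measurableSet_Ioi] with r hr
    simpa using oscF_norm_le a x θ r (le_of_lt hr) h1 h2

lemma osc_sub_integrable (a x θ : ℝ) (ha : 0 < a) (h1 : |a * θ| ≤ 1 / 2)
    (h2 : 0 ≤ x * Real.sin θ) :
    Integrable (fun t : ℝ => oscG a x (t + θ * Complex.I)) := by
  have h := oscF_integrable a x θ ha h1 h2
  rw [← Real.range_exp, ← Set.image_univ,
    integrableOn_image_iff_integrableOn_abs_deriv_smul MeasurableSet.univ
      (fun t _ => (Real.hasDerivAt_exp t).hasDerivWithinAt) Real.exp_injective.injOn,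
    integrableOn_univ] at h
  simpa only [oscG_eq] using h

lemma osc_sub_integral (a x θ : ℝ) :
    ∫ r in Set.Ioi 0, oscF a x θ r = ∫ t : ℝ, oscG a x (t + θ * Complex.I) := by
  rw [← Real.range_exp, ← Set.image_univ,
    integral_image_eq_integral_abs_deriv_smul MeasurableSet.univ
      (fun t _ => (Real.hasDerivAt_exp t).hasDerivWithinAt) Real.exp_injective.injOn,
    Measure.restrict_univ]
  simp only [oscG_eq]

lemma B_top (a : ℝ) (ha : 0 < a) : Filter.Tendsto
    (fun t : ℝ => Real.exp t * Real.exp (-(3 / 8) * (Real.exp t) ^ a)) Filter.atTop (nhds 0) := by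
  have h := tendsto_rpow_mul_exp_neg_mul_atTop_nhds_zero (1 / a) (3 / 8) (by norm_num)
  have h2 := h.comp ((tendsto_rpow_atTop ha).comp Real.tendsto_exp_atTop)
  refine h2.congr fun t => ?_
  simp only [Function.comp]
  rw [← Real.rpow_mul (Real.exp_pos t).le, mul_one_div_cancel ha.ne', Real.rpow_one]

lemma B_bot (a : ℝ) : Filter.Tendsto
    (fun t : ℝ => Real.exp t * Real.exp (-(3 / 8) * (Real.exp t) ^ a)) Filter.atBot (nhds 0) := by
  refine squeeze_zero (fun t => by positivity) (fun t => ?_) Real.tendsto_exp_atBot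
  refine mul_le_of_le_one_right (Real.exp_pos t).le (Real.exp_le_one_iff.2 ?_)
  have := Real.rpow_nonneg (Real.exp_pos t).le a
  linarith

lemma osc_rotate (a x θ : ℝ) (ha : 0 < a)
    (h1 : ∀ y ∈ Set.uIcc 0 θ, |a * y| ≤ 1 / 2) (h2 : ∀ y ∈ Set.uIcc 0 θ, 0 ≤ x * Real.sin y) :
    ∫ r in Set.Ioi 0, oscF a x 0 r = ∫ r in Set.Ioi 0, oscF a x θ r := by
  rw [osc_sub_integral, osc_sub_integral]
  have m0 : (0 : ℝ) ∈ Set.uIcc 0 θ := Set.left_mem_uIcc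
  have m1 : θ ∈ Set.uIcc 0 θ := Set.right_mem_uIcc
  have i0 := osc_sub_integrable a x 0 ha (h1 _ m0) (h2 _ m0)
  have i1 := osc_sub_integrable a x θ ha (h1 _ m1) (h2 _ m1)
  have t0 := intervalIntegral_tendsto_integral i0 Filter.tendsto_neg_atTop_atBot Filter.tendsto_id
  have t1 := intervalIntegral_tendsto_integral i1 Filter.tendsto_neg_atTop_atBot Filter.tendsto_id
  have key : ∀ l : Filter ℝ, Filter.Tendsto
      (fun t : ℝ => Real.exp t * Real.exp (-(3 / 8) * (Real.exp t) ^ a)) l (nhds 0) →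
      Filter.Tendsto (fun T : ℝ => ∫ y in (0 : ℝ)..θ, oscG a x (T + y * Complex.I)) l
        (nhds 0) := by
    intro l hl
    have hl' := hl.mul_const |θ - 0|
    rw [zero_mul] at hl'
    refine squeeze_zero_norm (fun T => ?_) hl'
    refine intervalIntegral.norm_integral_le_of_norm_le_const fun y hy => ?_
    have hy' := Set.uIoc_subset_uIcc hy
    exact oscG_norm_le a x y T (h1 y hy') (h2 y hy')
  have v1 := key _ (B_top a ha)
  have v0 := (key _ (B_bot a)).comp Filter.tendsto_neg_atTop_atBot
  have hd : Differentiable ℂ (oscG a x) := by unfold oscG; fun_prop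
  have tot := ((t0.sub t1).add (v1.const_smul Complex.I)).sub (v0.const_smul Complex.I)
  have hz : ∀ T : ℝ, _ := fun T => Complex.integral_boundary_rect_eq_zero_of_differentiableOn
    (oscG a x) ⟨-T, 0⟩ ⟨T, θ⟩ hd.differentiableOn
  have := tendsto_nhds_unique tot ((tendsto_const_nhds (x := (0 : ℂ))).congr fun T => (hz T).symm)
  simpa [sub_eq_zero] using this

lemma norm_exp_sub_one_le_of_re (z : ℂ) (hz : z.re ≤ 0) : ‖Complex.exp z - 1‖ ≤ ‖z‖ := by
  have h := Convex.norm_image_sub_le_of_norm_hasDerivWithin_le (𝕜 := ℂ) (f := Complex.exp)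
    (f' := Complex.exp) (s := {w : ℂ | w.re ≤ 0}) (x := 0) (y := z) (C := 1)
    (fun w _ => (Complex.hasDerivAt_exp w).hasDerivWithinAt)
    (fun w hw => by rw [Complex.norm_exp]; exact Real.exp_le_one_iff.2 hw)
    (convex_halfSpace_re_le 0) (by simp) hz
  simpa using h

lemma osc_half (a x θ : ℝ) (ha : 0 < a) (h1 : |a * θ| ≤ 1 / 2) (h2 : 0 < x * Real.sin θ) :
    ‖(∫ r in Set.Ioi 0, oscF a x θ r) - Complex.I / x‖ ≤
      2 * ((1 / (x * Real.sin θ)) ^ (a + 1) * Real.Gamma (a + 1)) := by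
  have hx : (x : ℂ) ≠ 0 := by
    rintro h
    rw [Complex.ofReal_eq_zero] at h
    simp [h] at h2
  set A : ℂ := Complex.I * (x * Complex.exp (θ * Complex.I)) with hA
  have hAre : A.re = -(x * Real.sin θ) := by
    have := re_phase2 x θ 1
    simpa [hA] using this
  have hAneg : A.re < 0 := by rw [hAre]; linarith
  have e1 : ∫ r in Set.Ioi (0 : ℝ), Complex.exp (θ * Complex.I) * Complex.exp (A * r)
      = Complex.I / x := by
    rw [integral_const_mul, integral_exp_mul_complex_Ioi hAneg]
    have : Complex.exp (θ * Complex.I) ≠ 0 := Complex.exp_ne_zero _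
    rw [hA]
    field_simp
    simp
  have i1 : IntegrableOn (fun r : ℝ => Complex.exp (θ * Complex.I) * Complex.exp (A * r))
      (Set.Ioi 0) := (integrableOn_exp_mul_complex_Ioi hAneg 0).const_mul _
  rw [← e1, ← integral_sub (oscF_integrable a x θ ha h1 h2.le) i1]
  rw [← Real.integral_rpow_mul_exp_neg_mul_Ioi (by linarith) h2, ← integral_const_mul]
  have hi := integrableOn_rpow_mul_exp_neg_mul_rpow (p := 1) (s := a) (b := x * Real.sin θ)
    (by linarith) one_pos h2
  refine norm_integral_le_of_norm_le (Integrable.const_mul ?_ 2) ?_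
  · simpa [IntegrableOn] using hi
  · filter_upwards [ae_restrict_mem measurableSet_Ioi] with r hr
    have hr : 0 < r := hr
    have hra := Real.rpow_nonneg hr.le a
    have e2 : oscF a x θ r - Complex.exp (θ * Complex.I) * Complex.exp (A * r) =
        Complex.exp (θ * Complex.I) * (Complex.exp (-(1 + Complex.I) *
          (Complex.exp ((a * θ : ℝ) * Complex.I) * ((r ^ a : ℝ) : ℂ))) - 1) *
          Complex.exp (A * r) := by
      rw [oscF, hA]; ring_nf
    have e3 : ‖Complex.exp (A * r)‖ = Real.exp (-(x * Real.sin θ * r)) := by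
      rw [Complex.norm_exp]; simp [hAre]
    have hc := cos_sub_sin_ge _ h1
    have e4 := norm_exp_sub_one_le_of_re (-(1 + Complex.I) *
          (Complex.exp ((a * θ : ℝ) * Complex.I) * ((r ^ a : ℝ) : ℂ)))
          (by rw [re_phase]; nlinarith)
    have e5 : ‖-(1 + Complex.I)‖ ≤ 2 := by
      rw [norm_neg]
      refine (norm_add_le _ _).trans ?_
      simp; norm_num
    rw [norm_mul, norm_mul, Complex.norm_exp_ofReal_mul_I, Complex.norm_real,
      Real.norm_of_nonneg hra, one_mul] at e4
    rw [e2, norm_mul, norm_mul, Complex.norm_exp_ofReal_mul_I, one_mul, e3, add_sub_cancel_right]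
    have e6 := e4.trans (mul_le_mul_of_nonneg_right e5 hra)
    exact (mul_le_mul_of_nonneg_right e6 (Real.exp_pos _).le).trans (le_of_eq (mul_assoc _ _ _))

lemma osc_half_bound (a x : ℝ) (ha : 0 < a) (hx : x ≠ 0) :
    ‖(∫ r in Set.Ioi 0, oscF a x 0 r) - Complex.I / x‖ ≤
      2 * ((1 / Real.sin (min 1 (1 / (2 * a)))) ^ (a + 1) * Real.Gamma (a + 1)) *
        |x| ^ (-1 - a) := by
  set θ₀ := min 1 (1 / (2 * a)) with hθ
  have p0 : 0 < θ₀ := by rw [hθ]; positivity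
  have p1 : θ₀ ≤ 1 := min_le_left _ _
  have p2 : a * θ₀ ≤ 1 / 2 := by
    calc a * θ₀ ≤ a * (1 / (2 * a)) := by gcongr; exact min_le_right _ _
      _ = 1 / 2 := by field_simp
  have hpi := Real.pi_gt_three
  have hs : 0 < Real.sin θ₀ := Real.sin_pos_of_pos_of_lt_pi p0 (by linarith)
  have fin : ∀ θ : ℝ, x * Real.sin θ = |x| * Real.sin θ₀ → (∀ y ∈ Set.uIcc 0 θ, |a * y| ≤ 1 / 2) →
      (∀ y ∈ Set.uIcc 0 θ, 0 ≤ x * Real.sin y) →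
      ‖(∫ r in Set.Ioi 0, oscF a x 0 r) - Complex.I / x‖ ≤
      2 * ((1 / Real.sin θ₀) ^ (a + 1) * Real.Gamma (a + 1)) * |x| ^ (-1 - a) := by
    intro θ e h1 h2
    have ax : 0 < |x| := abs_pos.2 hx
    have h := osc_half a x θ ha (h1 _ Set.right_mem_uIcc) (by rw [e]; positivity)
    rw [← osc_rotate a x θ ha h1 h2, e] at h
    refine h.trans (le_of_eq ?_)
    rw [show (-1 - a : ℝ) = -(a + 1) by ring, Real.rpow_neg ax.le, ← Real.inv_rpow ax.le,
      show 1 / (|x| * Real.sin θ₀) = (1 / Real.sin θ₀) * |x|⁻¹ by field_simp,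
      Real.mul_rpow (by positivity) (by positivity)]
    ring
  rcases lt_or_gt_of_ne hx with hx | hx
  · refine fin (-θ₀) (by rw [abs_of_neg hx, Real.sin_neg]; ring) ?_ ?_ <;> intro y hy <;>
      rw [Set.uIcc_of_ge (by linarith)] at hy <;> obtain ⟨y1, y2⟩ := hy
    · rw [abs_le]; constructor <;> nlinarith
    · exact mul_nonneg_of_nonpos_of_nonpos hx.le (Real.sin_nonpos_of_nonpos_of_neg_pi_le y2
        (by linarith))
  · refine fin θ₀ (by rw [abs_of_pos hx]) ?_ ?_ <;> intro y hy <;>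
      rw [Set.uIcc_of_le (by linarith)] at hy <;> obtain ⟨y1, y2⟩ := hy
    · rw [abs_le]; constructor <;> nlinarith
    · exact mul_nonneg hx.le (Real.sin_nonneg_of_nonneg_of_le_pi y1 (by linarith))

lemma osc_split (a x : ℝ) (ha : 0 < a) :
    ∫ ξ : ℝ, Complex.exp (-(1 + Complex.I) * ((|ξ| ^ a : ℝ) : ℂ)) *
          Complex.exp (Complex.I * ((x * ξ : ℝ) : ℂ)) =
      (∫ r in Set.Ioi 0, oscF a (-x) 0 r) + ∫ r in Set.Ioi 0, oscF a x 0 r := by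
  have i : ∀ z : ℝ, IntegrableOn (oscF a z 0) (Set.Ioi 0) := fun z =>
    oscF_integrable a z 0 ha (by simp) (by simp)
  have hpos : ∀ ξ ∈ Set.Ioi (0 : ℝ), oscF a x 0 ξ =
      Complex.exp (-(1 + Complex.I) * ((|ξ| ^ a : ℝ) : ℂ)) *
          Complex.exp (Complex.I * ((x * ξ : ℝ) : ℂ)) := by
    intro ξ hξ
    rw [abs_of_pos hξ]; simp [oscF]
  have hneg : ∀ ξ ∈ Set.Iic (0 : ℝ), oscF a (-x) 0 (-ξ) =
      Complex.exp (-(1 + Complex.I) * ((|ξ| ^ a : ℝ) : ℂ)) *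
          Complex.exp (Complex.I * ((x * ξ : ℝ) : ℂ)) := by
    intro ξ hξ
    rw [abs_of_nonpos hξ]; simp [oscF]
  have j : IntegrableOn (oscF a (-x) 0) (Set.Ici (-(0 : ℝ))) := by
    rw [neg_zero]
    exact (integrableOn_Ici_iff_integrableOn_Ioi (by simp)).mpr (i (-x))
  have j2 := IntegrableOn.comp_neg_Iic (c := (0 : ℝ)) j
  rw [← intervalIntegral.integral_Iic_add_Ioi (b := (0 : ℝ))
    (j2.congr_fun (fun ξ h => by simpa using hneg ξ h) measurableSet_Iic)
    ((i x).congr_fun hpos measurableSet_Ioi),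
    ← setIntegral_congr_fun measurableSet_Iic hneg, ← setIntegral_congr_fun measurableSet_Ioi hpos,
    integral_comp_neg_Iic, neg_zero]

theorem oscillatory_integral_decay (a : ℝ) (ha : 0 < a) :
    ∃ C : ℝ, 0 < C ∧ ∀ x : ℝ,
      ‖∫ ξ : ℝ, Complex.exp (-(1 + Complex.I) * ((|ξ| ^ a : ℝ) : ℂ)) *
          Complex.exp (Complex.I * ((x * ξ : ℝ) : ℂ))‖ ≤ C ∧
      (x ≠ 0 →
        ‖∫ ξ : ℝ, Complex.exp (-(1 + Complex.I) * ((|ξ| ^ a : ℝ) : ℂ)) *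
            Complex.exp (Complex.I * ((x * ξ : ℝ) : ℂ))‖ ≤ C * |x| ^ (-1 - a)) := by
  set C1 : ℝ := ∫ ξ : ℝ, Real.exp (-|ξ| ^ a)
  set C2 : ℝ := 2 * ((1 / Real.sin (min 1 (1 / (2 * a)))) ^ (a + 1) * Real.Gamma (a + 1))
  refine ⟨max 1 (max C1 (2 * C2)), by positivity, fun x => ⟨?_, fun hx => ?_⟩⟩
  · refine le_trans ?_ ((le_max_left C1 (2 * C2)).trans (le_max_right _ _))
    refine (norm_integral_le_integral_norm _).trans (le_of_eq ?_)
    refine integral_congr_ae (Filter.Eventually.of_forall fun ξ => ?_)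
    simp only [norm_mul, Complex.norm_exp]
    simp
  · have hb1 := osc_half_bound a x ha hx
    have hb2 := osc_half_bound a (-x) ha (neg_ne_zero.2 hx)
    rw [abs_neg] at hb2
    have hle : 2 * C2 ≤ max 1 (max C1 (2 * C2)) := (le_max_right _ _).trans (le_max_right _ _)
    rw [osc_split a x ha]
    calc _ = ‖((∫ r in Set.Ioi 0, oscF a (-x) 0 r) - Complex.I / (-x : ℝ)) +
          ((∫ r in Set.Ioi 0, oscF a x 0 r) - Complex.I / x)‖ := by
          congr 1; push_cast; rw [div_neg]; ring
      _ ≤ C2 * |x| ^ (-1 - a) + C2 * |x| ^ (-1 - a) := (norm_add_le _ _).trans (add_le_add hb2 hb1)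
      _ = 2 * C2 * |x| ^ (-1 - a) := by ring
      _ ≤ _ := by gcongr
end

section
/- Let a ∈ (0,1], γ ∈ (0,1], and P*_{a,γ} the maximal operator as above. Then for every f ∈ L¹(ℝ) and λ > 0, the Lebesgue measure of {x ∈ ℝ : P*_{a,γ} f(x) > λ} is at most C ‖f‖_{L¹} / λ. -/
open MeasureTheory

/-- Fourier transform with the normalization `f(x) = ∫ f̂(ξ) e^{ixξ} dξ`. -/
noncomputable def ftransform (f : ℝ → ℂ) (ξ : ℝ) : ℂ :=
  (1 / (2 * Real.pi)) * ∫ x : ℝ, f x * Complex.exp (-Complex.I * ((x * ξ : ℝ) : ℂ))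

/-- The fractional Schrödinger evolution with complex time `g(t) = t + i t^γ`,
applied to a function with Fourier transform `fhat`. -/
noncomputable def Pop (a γ : ℝ) (fhat : ℝ → ℂ) (t x : ℝ) : ℂ :=
  ∫ ξ : ℝ, fhat ξ *
    Complex.exp (Complex.I * ((t * |ξ| ^ a : ℝ) : ℂ) - ((t ^ γ * |ξ| ^ a : ℝ) : ℂ)) *
    Complex.exp (Complex.I * ((x * ξ : ℝ) : ℂ))

/-- The maximal operator `P*_{a,γ} f(x) = sup_{0<t<1} |P^t_{a,γ} f(x)|`. -/
noncomputable def Pstar (a γ : ℝ) (fhat : ℝ → ℂ) (x : ℝ) : ℝ :=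
  ⨆ t : Set.Ioo (0 : ℝ) 1, ‖Pop a γ fhat t x‖

open Set Filter Topology

lemma hl_weak (f : ℝ → ℂ) (hf : Integrable f volume) (A : ℝ) (hA : 0 < A) :
    volume {x : ℝ | ∃ ρ : ℝ, 0 < ρ ∧
      ENNReal.ofReal (A * ρ) < ∫⁻ y in Metric.closedBall x ρ, ‖f y‖ₑ} ≤
      ENNReal.ofReal (10 / A) * ∫⁻ y, ‖f y‖ₑ := by
  set S := {x : ℝ | ∃ ρ : ℝ, 0 < ρ ∧
      ENNReal.ofReal (A * ρ) < ∫⁻ y in Metric.closedBall x ρ, ‖f y‖ₑ} with hS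
  have hfin : (∫⁻ y, ‖f y‖ₑ) < ⊤ := hf.2
  have hch : ∀ x : ℝ, ∃ ρ : ℝ, x ∈ S → 0 < ρ ∧
      ENNReal.ofReal (A * ρ) < ∫⁻ y in Metric.closedBall x ρ, ‖f y‖ₑ := by
    intro x
    by_cases hx : x ∈ S
    · obtain ⟨ρ, h⟩ := hx
      exact ⟨ρ, fun _ => h⟩
    · exact ⟨0, fun h => absurd h hx⟩
  choose r hr using hch
  have hbd : ∀ x ∈ S, r x ≤ (∫⁻ y, ‖f y‖ₑ).toReal / A := by
    intro x hx
    obtain ⟨h0, h1⟩ := hr x hx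
    have h2 : ENNReal.ofReal (A * r x) ≤ ∫⁻ y, ‖f y‖ₑ :=
      h1.le.trans (setLIntegral_le_lintegral _ _)
    rw [ENNReal.ofReal_le_iff_le_toReal hfin.ne] at h2
    rw [le_div_iff₀ hA]
    linarith
  obtain ⟨u, huS, hdisj, hcov⟩ :=
    Vitali.exists_disjoint_subfamily_covering_enlargement_closedBall S (fun x : ℝ => x) r _ hbd 5
      (by norm_num)
  have hcount : u.Countable := by
    refine hdisj.countable_of_nonempty_interior fun x hx => ?_
    exact ⟨x, Metric.ball_subset_interior_closedBall
      (Metric.mem_ball_self (hr x (huS hx)).1)⟩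
  have hsub : S ⊆ ⋃ x ∈ u, Metric.closedBall x (5 * r x) := by
    intro x hx
    obtain ⟨b, hb, hb'⟩ := hcov x hx
    exact mem_biUnion hb (hb' (Metric.mem_closedBall_self (hr x hx).1.le))
  calc volume S ≤ volume (⋃ x ∈ u, Metric.closedBall x (5 * r x)) := measure_mono hsub
    _ ≤ ∑' x : u, volume (Metric.closedBall (x : ℝ) (5 * r x)) := measure_biUnion_le _ hcount _
    _ ≤ ∑' x : u, ENNReal.ofReal (10 / A) * ∫⁻ y in Metric.closedBall (x : ℝ) (r x), ‖f y‖ₑ := by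
        refine ENNReal.tsum_le_tsum fun x => ?_
        have h := hr x (huS x.2)
        rw [Real.volume_closedBall]
        calc ENNReal.ofReal (2 * (5 * r x)) = ENNReal.ofReal (10 / A) * ENNReal.ofReal (A * r x) := by
              rw [← ENNReal.ofReal_mul (by positivity)]
              congr 1
              field_simp
              ring
          _ ≤ _ := by gcongr; exact h.2.le
    _ = ENNReal.ofReal (10 / A) * ∑' x : u, ∫⁻ y in Metric.closedBall (x : ℝ) (r x), ‖f y‖ₑ :=
        ENNReal.tsum_mul_left
    _ = ENNReal.ofReal (10 / A) * ∫⁻ y in ⋃ x ∈ u, Metric.closedBall (x : ℝ) (r x), ‖f y‖ₑ := by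
        rw [lintegral_biUnion hcount (fun x _ => Metric.isClosed_closedBall.measurableSet) hdisj]
    _ ≤ _ := mul_le_mul_right (setLIntegral_le_lintegral _ _) _

lemma conv_bound (f : ℝ → ℂ) (hf : Integrable f volume) (A r x : ℝ) (hA : 0 < A) (hr : 0 < r)
    (h : ∀ ρ : ℝ, 0 < ρ → ∫⁻ y in Metric.closedBall x ρ, ‖f y‖ₑ ≤ ENNReal.ofReal (A * ρ))
    (E : ℝ → ℂ) (h1 : ∀ u, ‖E u‖ ≤ 2 * r ^ 2) (h2 : ∀ u, u ≠ 0 → ‖E u‖ ≤ 4 / u ^ 2) :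
    ∫⁻ y, ‖f y * E (x - y)‖ₑ ≤ ENNReal.ofReal (32 * A * r) := by
  have hpt : ∀ y, ‖f y * E (x - y)‖ₑ ≤ ∑' n : ℕ, ENNReal.ofReal (16 * r ^ 2 * (1 / 4) ^ n) *
      (Metric.closedBall x (2 ^ n / r)).indicator (fun y => ‖f y‖ₑ) y := by
    intro y
    obtain ⟨n, hn, hE⟩ : ∃ n : ℕ, |x - y| ≤ 2 ^ n / r ∧ ‖E (x - y)‖ ≤ 16 * r ^ 2 * (1 / 4) ^ n := by
      by_cases hc : 1 ≤ |x - y| * r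
      · obtain ⟨n, hn1, hn2⟩ := exists_nat_pow_near hc (one_lt_two)
        refine ⟨n + 1, ?_, ?_⟩
        · rw [le_div_iff₀ hr]; exact hn2.le
        · have hne : x - y ≠ 0 := by
            intro h0; rw [h0] at hc; norm_num at hc
          refine (h2 _ hne).trans ?_
          have h3 : ((2:ℝ) ^ n) ^ 2 ≤ (|x - y| * r) ^ 2 := by gcongr
          rw [mul_pow, sq_abs, ← pow_mul, mul_comm n 2, pow_mul] at h3
          norm_num at h3
          have h4 : (0:ℝ) < 4 ^ n := by positivity
          have h5 : 0 < (x - y) ^ 2 := by positivity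
          rw [div_le_iff₀ h5, one_div, inv_pow, pow_succ (4:ℝ) n]
          have : 16 * r ^ 2 * (4 ^ n * 4)⁻¹ * (x - y) ^ 2 = 4 * ((x - y) ^ 2 * r ^ 2 / 4 ^ n) := by
            field_simp; norm_num
          rw [this]
          have := (one_le_div h4).2 h3
          linarith
      · push Not at hc
        refine ⟨0, ?_, ?_⟩
        · rw [le_div_iff₀ hr]; simpa using hc.le
        · refine (h1 _).trans ?_
          nlinarith [sq_nonneg r]
    refine le_trans ?_ (ENNReal.le_tsum n)
    have hmem : y ∈ Metric.closedBall x (2 ^ n / r) := by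
      rw [Metric.mem_closedBall, Real.dist_eq, abs_sub_comm]; exact hn
    rw [indicator_of_mem hmem, enorm_mul, mul_comm]
    gcongr
    rw [← ofReal_norm]
    exact ENNReal.ofReal_le_ofReal hE
  calc ∫⁻ y, ‖f y * E (x - y)‖ₑ ≤ ∫⁻ y, ∑' n : ℕ, ENNReal.ofReal (16 * r ^ 2 * (1 / 4) ^ n) *
      (Metric.closedBall x (2 ^ n / r)).indicator (fun y => ‖f y‖ₑ) y := lintegral_mono hpt
    _ = ∑' n : ℕ, ∫⁻ y, ENNReal.ofReal (16 * r ^ 2 * (1 / 4) ^ n) *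
      (Metric.closedBall x (2 ^ n / r)).indicator (fun y => ‖f y‖ₑ) y := by
        refine lintegral_tsum fun n => ?_
        exact (hf.1.enorm.indicator Metric.isClosed_closedBall.measurableSet).const_mul _
    _ ≤ ∑' n : ℕ, ENNReal.ofReal (16 * A * r * (1 / 2) ^ n) := by
        refine ENNReal.tsum_le_tsum fun n => ?_
        rw [lintegral_const_mul' _ _ ENNReal.ofReal_ne_top,
          lintegral_indicator Metric.isClosed_closedBall.measurableSet]
        calc _ ≤ ENNReal.ofReal (16 * r ^ 2 * (1 / 4) ^ n) * ENNReal.ofReal (A * (2 ^ n / r)) := by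
              gcongr; exact h _ (by positivity)
          _ = _ := by
              rw [← ENNReal.ofReal_mul (by positivity)]
              congr 1
              have : (4:ℝ) ^ n = 2 ^ n * 2 ^ n := by rw [← mul_pow]; norm_num
              simp only [one_div, inv_pow, this]
              field_simp
          _ ≤ _ := le_rfl
    _ = ENNReal.ofReal (∑' n : ℕ, 16 * A * r * (1 / 2) ^ n) := by
        rw [ENNReal.ofReal_tsum_of_nonneg (fun n => by positivity)]
        exact (summable_geometric_two).mul_left _
    _ = _ := by
        rw [tsum_mul_left, tsum_geometric_two]; congr 1; ring

/-- The Fejer kernel. -/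
noncomputable def fejer (r u : ℝ) : ℂ :=
  ∫ ξ : ℝ, ((max (r - |ξ|) 0 : ℝ) : ℂ) * Complex.exp (Complex.I * ((u * ξ : ℝ) : ℂ))

lemma norm_expI (s : ℝ) : ‖Complex.exp (Complex.I * (s : ℂ))‖ = 1 := by
  rw [mul_comm]; exact Complex.norm_exp_ofReal_mul_I s

lemma fejer_eq (r u : ℝ) (hr : 0 < r) : fejer r u =
    ∫ ξ in (-r)..r, ((r - |ξ| : ℝ) : ℂ) * Complex.exp (Complex.I * ((u * ξ : ℝ) : ℂ)) := by
  rw [intervalIntegral.integral_of_le (by linarith), fejer,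
    ← setIntegral_eq_integral_of_forall_compl_eq_zero (s := Ioc (-r) r)]
  · refine setIntegral_congr_fun measurableSet_Ioc fun ξ hξ => ?_
    have : |ξ| ≤ r := abs_le.2 ⟨hξ.1.le, hξ.2⟩
    rw [max_eq_left (by linarith)]
  · intro ξ hξ
    have : r ≤ |ξ| := by
      by_contra hc
      push Not at hc
      rw [abs_lt] at hc
      exact hξ ⟨hc.1, hc.2.le⟩
    rw [max_eq_right (by linarith)]
    simp

lemma fejer_le1 (r u : ℝ) (hr : 0 < r) : ‖fejer r u‖ ≤ 2 * r ^ 2 := by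
  rw [fejer_eq r u hr]
  refine (intervalIntegral.norm_integral_le_of_norm_le_const (C := r) ?_).trans ?_
  · intro ξ hξ
    rw [uIoc_of_le (by linarith)] at hξ
    have : |ξ| ≤ r := abs_le.2 ⟨hξ.1.le, hξ.2⟩
    rw [norm_mul, norm_expI, mul_one, Complex.norm_real, Real.norm_eq_abs, abs_of_nonneg (by linarith)]
    linarith [abs_nonneg ξ]
  · rw [abs_of_nonneg (by linarith)]
    nlinarith

lemma fejer_le2 (r u : ℝ) (hr : 0 < r) (hu : u ≠ 0) : ‖fejer r u‖ ≤ 4 / u ^ 2 := by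
  have hIu : Complex.I * (u : ℂ) ≠ 0 := mul_ne_zero Complex.I_ne_zero (by exact_mod_cast hu)
  set c : ℂ := Complex.I * (u : ℂ) with hc
  have hcont : Continuous fun ξ : ℝ => ((r - |ξ| : ℝ) : ℂ) *
      Complex.exp (Complex.I * ((u * ξ : ℝ) : ℂ)) := by fun_prop
  have hexp : ∀ ξ : ℝ, HasDerivAt (fun ξ : ℝ => Complex.exp (c * (ξ : ℂ)))
      (c * Complex.exp (c * (ξ : ℂ))) ξ := by
    intro ξ
    have := ((Complex.ofRealCLM.hasDerivAt (x := ξ)).const_mul c).cexp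
    simpa [mul_comm] using this
  have hid : ∀ ξ : ℝ, HasDerivAt (fun ξ : ℝ => (ξ : ℂ)) 1 ξ := fun ξ => by
    exact Complex.ofRealCLM.hasDerivAt (x := ξ)
  have hA : ∫ ξ in (0:ℝ)..r, ((r - |ξ| : ℝ) : ℂ) * Complex.exp (Complex.I * ((u * ξ : ℝ) : ℂ)) =
      Complex.exp (c * r) / c ^ 2 - r / c - 1 / c ^ 2 := by
    rw [intervalIntegral.integral_congr (g := fun ξ : ℝ => ((r : ℂ) - ξ) * Complex.exp (c * ξ))]
    · rw [intervalIntegral.integral_eq_sub_of_hasDerivAt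
        (f := fun ξ : ℝ => ((r : ℂ) - ξ) * Complex.exp (c * ξ) / c + Complex.exp (c * ξ) / c ^ 2)]
      · simp
        ring
      · intro ξ _
        convert! ((((hid ξ).const_sub (r : ℂ)).mul (hexp ξ)).div_const c).add
          ((hexp ξ).div_const (c ^ 2)) using 1
        field_simp
        ring
      · exact Continuous.intervalIntegrable (by fun_prop) _ _
    · intro ξ hξ
      rw [uIcc_of_le hr.le] at hξ
      simp only
      rw [abs_of_nonneg hξ.1, hc]
      push_cast
      ring_nf
  have hB : ∫ ξ in (-r)..(0:ℝ), ((r - |ξ| : ℝ) : ℂ) * Complex.exp (Complex.I * ((u * ξ : ℝ) : ℂ)) =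
      Complex.exp (c * (-r : ℝ)) / c ^ 2 + r / c - 1 / c ^ 2 := by
    rw [intervalIntegral.integral_congr (g := fun ξ : ℝ => ((r : ℂ) + ξ) * Complex.exp (c * ξ))]
    · rw [intervalIntegral.integral_eq_sub_of_hasDerivAt
        (f := fun ξ : ℝ => ((r : ℂ) + ξ) * Complex.exp (c * ξ) / c - Complex.exp (c * ξ) / c ^ 2)]
      · simp
        ring
      · intro ξ _
        convert! ((((hid ξ).const_add (r : ℂ)).mul (hexp ξ)).div_const c).sub
          ((hexp ξ).div_const (c ^ 2)) using 1
        field_simp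
        ring
      · exact Continuous.intervalIntegrable (by fun_prop) _ _
    · intro ξ hξ
      rw [uIcc_of_le (by linarith)] at hξ
      simp only
      rw [abs_of_nonpos hξ.2, hc]
      push_cast
      ring_nf
  rw [fejer_eq r u hr, ← intervalIntegral.integral_add_adjacent_intervals (b := 0)
    (hcont.intervalIntegrable _ _) (hcont.intervalIntegrable _ _), hA, hB]
  have hn : ∀ s : ℝ, ‖Complex.exp (c * s)‖ = 1 := by
    intro s
    rw [hc, mul_assoc, ← Complex.ofReal_mul]; exact norm_expI _
  have e : Complex.exp (c * (-r : ℝ)) / c ^ 2 + r / c - 1 / c ^ 2 +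
      (Complex.exp (c * r) / c ^ 2 - r / c - 1 / c ^ 2) =
      (Complex.exp (c * (-r : ℝ)) + Complex.exp (c * r) - 2) / c ^ 2 := by ring
  have hcn : ‖c ^ 2‖ = u ^ 2 := by rw [hc]; simp
  rw [e, norm_div, hcn]
  gcongr
  refine (norm_sub_le _ _).trans ?_
  have := norm_add_le (Complex.exp (c * (-r : ℝ))) (Complex.exp (c * r))
  rw [hn, hn] at this
  have h2 : ‖(2:ℂ)‖ = 2 := by simp
  linarith

lemma ftransform_le (f : ℝ → ℂ) (ξ : ℝ) : ‖ftransform f ξ‖ ≤ ∫ y, ‖f y‖ := by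
  have hpi : ‖(1 / (2 * Real.pi) : ℂ)‖ ≤ 1 := by
    rw [norm_div, norm_mul, Complex.norm_real, Real.norm_of_nonneg Real.pi_pos.le]
    simp only [norm_one, Complex.norm_ofNat]
    rw [div_le_one (by positivity)]
    linarith [Real.pi_gt_three]
  rw [ftransform, norm_mul]
  calc _ ≤ 1 * ‖∫ x : ℝ, f x * Complex.exp (-Complex.I * ((x * ξ : ℝ) : ℂ))‖ := by gcongr
    _ ≤ ∫ x : ℝ, ‖f x * Complex.exp (-Complex.I * ((x * ξ : ℝ) : ℂ))‖ := by
      rw [one_mul]; exact norm_integral_le_integral_norm _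
    _ = _ := by
      congr 1; ext x
      have : -Complex.I * ((x * ξ : ℝ) : ℂ) = Complex.I * ((-(x * ξ) : ℝ) : ℂ) := by
        push_cast; ring
      rw [norm_mul, this, norm_expI, mul_one]

lemma ftransform_cont (f : ℝ → ℂ) (hf : Integrable f volume) : Continuous (ftransform f) := by
  unfold ftransform
  refine continuous_const.mul ?_
  refine continuous_of_dominated (bound := fun y => ‖f y‖) ?_ ?_ hf.norm ?_
  · intro ξ
    exact hf.1.mul (Continuous.aestronglyMeasurable (by fun_prop))
  · intro ξ
    refine Eventually.of_forall fun x => ?_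
    have : -Complex.I * ((x * ξ : ℝ) : ℂ) = Complex.I * ((-(x * ξ) : ℝ) : ℂ) := by
      push_cast; ring
    rw [norm_mul, this, norm_expI, mul_one]
  · refine Eventually.of_forall fun x => ?_
    fun_prop

lemma tri_integrable (r : ℝ) : Integrable (fun ξ : ℝ => ((max (r - |ξ|) 0 : ℝ) : ℂ)) volume := by
  refine Continuous.integrable_of_hasCompactSupport (by fun_prop) ?_
  refine HasCompactSupport.intro (K := Icc (-|r|) |r|) isCompact_Icc fun ξ hξ => ?_
  have : r ≤ |ξ| := by
    by_contra hc
    push Not at hc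
    have h2 := abs_lt.1 hc
    have := le_abs_self r
    exact hξ ⟨by linarith, by linarith⟩
  rw [max_eq_right (by linarith)]; simp

lemma fejer_mean_bound (f : ℝ → ℂ) (hf : Integrable f volume) (A r x : ℝ) (hA : 0 < A) (hr : 0 < r)
    (h : ∀ ρ : ℝ, 0 < ρ → ∫⁻ y in Metric.closedBall x ρ, ‖f y‖ₑ ≤ ENNReal.ofReal (A * ρ)) :
    ‖∫ ξ : ℝ, ftransform f ξ * ((max (r - |ξ|) 0 : ℝ) : ℂ) *
      Complex.exp (Complex.I * ((x * ξ : ℝ) : ℂ))‖ ≤ 32 * A * r := by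
  have hpi : ‖(1 / (2 * Real.pi) : ℂ)‖ ≤ 1 := by
    rw [norm_div, norm_mul, Complex.norm_real, Real.norm_of_nonneg Real.pi_pos.le]
    simp only [norm_one, Complex.norm_ofNat]
    rw [div_le_one (by positivity)]
    linarith [Real.pi_gt_three]
  have e : ∫ ξ : ℝ, ftransform f ξ * ((max (r - |ξ|) 0 : ℝ) : ℂ) *
      Complex.exp (Complex.I * ((x * ξ : ℝ) : ℂ)) =
      (1 / (2 * Real.pi)) * ∫ y, f y * fejer r (x - y) := by
    have e1 : ∀ ξ : ℝ, ftransform f ξ * ((max (r - |ξ|) 0 : ℝ) : ℂ) *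
      Complex.exp (Complex.I * ((x * ξ : ℝ) : ℂ)) = (1 / (2 * Real.pi)) *
        ∫ y, f y * (((max (r - |ξ|) 0 : ℝ) : ℂ) *
          Complex.exp (Complex.I * (((x - y) * ξ : ℝ) : ℂ))) := by
      intro ξ
      rw [ftransform, mul_assoc, mul_assoc, ← integral_mul_const]
      congr 2
      ext y
      have : Complex.exp (Complex.I * (((x - y) * ξ : ℝ) : ℂ)) =
          Complex.exp (-Complex.I * ((y * ξ : ℝ) : ℂ)) *
          Complex.exp (Complex.I * ((x * ξ : ℝ) : ℂ)) := by
        rw [← Complex.exp_add]; congr 1; push_cast; ring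
      rw [this]; ring
    simp_rw [e1]
    rw [integral_const_mul, integral_integral_swap]
    · simp_rw [integral_const_mul]
      rfl
    · have h1 : Integrable (fun p : ℝ × ℝ => ((max (r - |p.1|) 0 : ℝ) : ℂ) * f p.2)
          (volume.prod volume) := (tri_integrable r).mul_prod hf
      have h2 : Integrable (fun p : ℝ × ℝ => (((max (r - |p.1|) 0 : ℝ) : ℂ) * f p.2) *
          Complex.exp (Complex.I * (((x - p.2) * p.1 : ℝ) : ℂ))) (volume.prod volume) := by
        refine h1.mul_bdd (c := 1) (Continuous.aestronglyMeasurable (by fun_prop)) ?_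
        exact Eventually.of_forall fun p => (norm_expI _).le
      refine h2.congr (Eventually.of_forall fun p => ?_)
      simp only [Function.uncurry]
      ring
  rw [e, norm_mul]
  have hb := conv_bound f hf A r x hA hr h (fejer r) (fun u => fejer_le1 r u hr)
    (fun u hu => fejer_le2 r u hr hu)
  have hb2 : ‖∫ y, f y * fejer r (x - y)‖ ≤ 32 * A * r := by
    have h3 := (enorm_integral_le_lintegral_enorm (fun y => f y * fejer r (x - y))).trans hb
    rw [← ofReal_norm] at h3
    exact (ENNReal.ofReal_le_ofReal_iff (by positivity)).1 h3
  calc _ ≤ 1 * ‖∫ y, f y * fejer r (x - y)‖ := by gcongr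
    _ ≤ _ := by rw [one_mul]; exact hb2

noncomputable def psi (a : ℝ) (w : ℂ) (r : ℝ) : ℂ := Complex.exp (-w * ((r ^ a : ℝ) : ℂ))

noncomputable def psi1 (a : ℝ) (w : ℂ) (r : ℝ) : ℂ :=
  -w * a * ((r ^ (a - 1) : ℝ) : ℂ) * psi a w r

noncomputable def psi2 (a : ℝ) (w : ℂ) (r : ℝ) : ℂ :=
  (-w * a * ((a - 1 : ℝ) : ℂ) * ((r ^ (a - 2) : ℝ) : ℂ) + w ^ 2 * a ^ 2 * ((r ^ (2 * a - 2) : ℝ) : ℂ))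
    * psi a w r

noncomputable def Bd (a T r : ℝ) : ℝ :=
  2 * T * a * (r ^ (a - 1) * Real.exp (-T * r ^ a)) +
    4 * T ^ 2 * a ^ 2 * (r ^ (2 * a - 1) * Real.exp (-T * r ^ a))

lemma norm_psi (a : ℝ) (w : ℂ) (r : ℝ) : ‖psi a w r‖ = Real.exp (-w.re * r ^ a) := by
  rw [psi, Complex.norm_exp]
  simp

lemma psi_deriv (a : ℝ) (w : ℂ) (r : ℝ) (hr : 0 < r) :
    HasDerivAt (psi a w) (psi1 a w r) r := by
  have h1 : HasDerivAt (fun r : ℝ => ((r ^ a : ℝ) : ℂ)) ((a * r ^ (a - 1) : ℝ) : ℂ) r :=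
    (Real.hasDerivAt_rpow_const (Or.inl hr.ne')).ofReal_comp
  have h2 := (h1.const_mul (-w)).cexp
  convert! h2 using 1
  rw [psi1, psi]
  push_cast
  ring

lemma psi1_deriv (a : ℝ) (w : ℂ) (r : ℝ) (hr : 0 < r) :
    HasDerivAt (psi1 a w) (psi2 a w r) r := by
  have h1 : HasDerivAt (fun r : ℝ => ((r ^ (a - 1) : ℝ) : ℂ))
      (((a - 1) * r ^ (a - 1 - 1) : ℝ) : ℂ) r :=
    (Real.hasDerivAt_rpow_const (Or.inl hr.ne')).ofReal_comp
  have h2 := (h1.const_mul (-w * a)).mul (psi_deriv a w r hr)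
  convert! h2 using 1
  have e1 : r ^ (2 * a - 2) = r ^ (a - 1) * r ^ (a - 1) := by
    rw [← Real.rpow_add hr]; congr 1; ring
  have e2 : a - 1 - 1 = a - 2 := by ring
  rw [psi2, psi1, e1, e2]
  push_cast
  ring

lemma psi2_bound (a T : ℝ) (w : ℂ) (r : ℝ) (hr : 0 < r) (ha : 0 < a) (ha1 : a ≤ 1)
    (hw : w.re = T) (hT : 0 < T) (hw2 : ‖w‖ ≤ 2 * T) : r * ‖psi2 a w r‖ ≤ Bd a T r := by
  have e1 : r ^ (a - 1) = r * r ^ (a - 2) := by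
    nth_rewrite 2 [← Real.rpow_one r]
    rw [← Real.rpow_add hr]; congr 1; ring
  have e2 : r ^ (2 * a - 1) = r * r ^ (2 * a - 2) := by
    nth_rewrite 2 [← Real.rpow_one r]
    rw [← Real.rpow_add hr]; congr 1; ring
  have hp1 : 0 < r ^ (a - 2) := Real.rpow_pos_of_pos hr _
  have hp2 : 0 < r ^ (2 * a - 2) := Real.rpow_pos_of_pos hr _
  have h1 : ‖-w * a * ((a - 1 : ℝ) : ℂ) * ((r ^ (a - 2) : ℝ) : ℂ)‖ ≤ 2 * T * a * r ^ (a - 2) := by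
    rw [norm_mul, norm_mul, norm_mul, norm_neg, Complex.norm_real, Complex.norm_real,
      Complex.norm_real, Real.norm_of_nonneg ha.le, Real.norm_of_nonneg hp1.le, Real.norm_eq_abs]
    have : |a - 1| ≤ 1 := abs_le.2 ⟨by linarith, by linarith⟩
    calc ‖w‖ * a * |a - 1| * r ^ (a - 2) ≤ (2 * T) * a * 1 * r ^ (a - 2) := by gcongr
      _ = _ := by ring
  have h2 : ‖w ^ 2 * a ^ 2 * ((r ^ (2 * a - 2) : ℝ) : ℂ)‖ ≤ 4 * T ^ 2 * a ^ 2 * r ^ (2 * a - 2) := by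
    rw [norm_mul, norm_mul, norm_pow, norm_pow, Complex.norm_real, Complex.norm_real,
      Real.norm_of_nonneg ha.le, Real.norm_of_nonneg hp2.le]
    calc ‖w‖ ^ 2 * a ^ 2 * r ^ (2 * a - 2) ≤ (2 * T) ^ 2 * a ^ 2 * r ^ (2 * a - 2) := by gcongr
      _ = _ := by ring
  rw [psi2, norm_mul, norm_psi, hw, Bd, e1, e2]
  calc _ ≤ r * ((2 * T * a * r ^ (a - 2) + 4 * T ^ 2 * a ^ 2 * r ^ (2 * a - 2)) *
      Real.exp (-T * r ^ a)) := by
        gcongr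
        exact (norm_add_le _ _).trans (add_le_add h1 h2)
    _ = _ := by ring

lemma Bd_integrable (a T : ℝ) (ha : 0 < a) (hT : 0 < T) : IntegrableOn (Bd a T) (Ioi 0) := by
  unfold Bd
  exact ((integrableOn_rpow_mul_exp_neg_mul_rpow (by linarith) ha hT).const_mul _).add
    ((integrableOn_rpow_mul_exp_neg_mul_rpow (by linarith) ha hT).const_mul _)

lemma Bd_integrable2 (a T : ℝ) (ha : 0 < a) (hT : 0 < T) :
    IntegrableOn (fun r => (1 + r ^ 2) * Bd a T r) (Ioi 0) := by
  have h : IntegrableOn (fun r => 2 * T * a * (r ^ (a + 1) * Real.exp (-T * r ^ a)) +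
    4 * T ^ 2 * a ^ 2 * (r ^ (2 * a + 1) * Real.exp (-T * r ^ a))) (Ioi 0) :=
    ((integrableOn_rpow_mul_exp_neg_mul_rpow (by linarith) ha hT).const_mul _).add
    ((integrableOn_rpow_mul_exp_neg_mul_rpow (by linarith) ha hT).const_mul _)
  refine ((Bd_integrable a T ha hT).add h).congr_fun ?_ measurableSet_Ioi
  intro r hr
  have hr : 0 < r := hr
  have e1 : r ^ (a + 1) = r ^ (a - 1) * r ^ 2 := by
    rw [← Real.rpow_natCast, ← Real.rpow_add hr]; congr 1; push_cast; ring
  have e2 : r ^ (2 * a + 1) = r ^ (2 * a - 1) * r ^ 2 := by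
    rw [← Real.rpow_natCast, ← Real.rpow_add hr]; congr 1; push_cast; ring
  simp only [Pi.add_apply, Bd, e1, e2]
  ring

lemma Bd_integral (a T : ℝ) (ha : 0 < a) (ha1 : a ≤ 1) (hT : 0 < T) :
    ∫ r in Ioi 0, Bd a T r ≤ 6 := by
  unfold Bd
  rw [integral_add ((integrableOn_rpow_mul_exp_neg_mul_rpow (by linarith) ha hT).const_mul _)
    ((integrableOn_rpow_mul_exp_neg_mul_rpow (by linarith) ha hT).const_mul _),
    integral_const_mul, integral_const_mul, integral_rpow_mul_exp_neg_mul_rpow ha (by linarith) hT,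
    integral_rpow_mul_exp_neg_mul_rpow ha (by linarith) hT]
  have e1 : (a - 1 + 1) / a = 1 := by field_simp; ring
  have e2 : (2 * a - 1 + 1) / a = 2 := by field_simp; ring
  rw [neg_div, neg_div, e1, e2, Real.Gamma_one, Real.Gamma_two, Real.rpow_neg hT.le,
    Real.rpow_neg hT.le, Real.rpow_one, Real.rpow_two]
  have : 2 * T * a * (T⁻¹ * (1 / a) * 1) + 4 * T ^ 2 * a ^ 2 * ((T ^ 2)⁻¹ * (1 / a) * 1) =
      2 + 4 * a := by field_simp
  rw [this]; linarith

lemma psi2_meas (a : ℝ) (w : ℂ) : Measurable (psi2 a w) := by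
  unfold psi2 psi
  fun_prop

lemma psi_rep (a T : ℝ) (w : ℂ) (ha : 0 < a) (ha1 : a ≤ 1)
    (hw : w.re = T) (hT : 0 < T) (hw2 : ‖w‖ ≤ 2 * T) (s : ℝ) (hs : 0 < s) :
    ∫ r in Ioi 0, ((max (r - s) 0 : ℝ) : ℂ) * psi2 a w r = psi a w s := by
  have e1 : ∫ r in Ioi s, ((max (r - s) 0 : ℝ) : ℂ) * psi2 a w r =
      ∫ r in Ioi 0, ((max (r - s) 0 : ℝ) : ℂ) * psi2 a w r := by
    refine (setIntegral_eq_of_subset_of_forall_sdiff_eq_zero measurableSet_Ioi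
      (Ioi_subset_Ioi hs.le) ?_).symm
    intro r hr
    have : r ≤ s := not_lt.1 hr.2
    rw [max_eq_right (by linarith)]; simp
  have e2 : ∫ r in Ioi s, ((max (r - s) 0 : ℝ) : ℂ) * psi2 a w r =
      ∫ r in Ioi s, ((r : ℂ) - s) * psi2 a w r := by
    refine setIntegral_congr_fun measurableSet_Ioi fun r hr => ?_
    have hr : s < r := hr
    rw [max_eq_left (by linarith)]; push_cast; rfl
  have hid : ∀ ξ : ℝ, HasDerivAt (fun ξ : ℝ => (ξ : ℂ)) 1 ξ := fun ξ => by
    exact Complex.ofRealCLM.hasDerivAt (x := ξ)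
  have hz : ∀ p : ℝ, Tendsto (fun r : ℝ => (r ^ a) ^ p * Real.exp (-T * r ^ a)) atTop (𝓝 0) :=
    fun p => (tendsto_rpow_mul_exp_neg_mul_atTop_nhds_zero p T hT).comp (tendsto_rpow_atTop ha)
  have hpsi0 : Tendsto (psi a w) atTop (𝓝 0) := by
    rw [tendsto_zero_iff_norm_tendsto_zero]
    refine (hz 0).congr fun r => ?_
    rw [norm_psi, hw, Real.rpow_zero, one_mul]
  have hpsi1 : Tendsto (fun r : ℝ => ((r : ℂ) - s) * psi1 a w r) atTop (𝓝 0) := by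
    refine squeeze_zero_norm' (a := fun r : ℝ => ‖w‖ * a * ((r ^ a) ^ (1:ℝ) *
      Real.exp (-T * r ^ a))) ?_ ?_
    · filter_upwards [eventually_gt_atTop s] with r hr
      have hr0 : 0 < r := hs.trans hr
      have hp1 : 0 < r ^ (a - 1) := Real.rpow_pos_of_pos hr0 _
      have e1 : r ^ a = r * r ^ (a - 1) := by
        nth_rewrite 2 [← Real.rpow_one r]
        rw [← Real.rpow_add hr0]; congr 1; ring
      have h3 : ‖(r : ℂ) - s‖ ≤ r := by
        rw [← Complex.ofReal_sub, Complex.norm_real, Real.norm_of_nonneg (by linarith)]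
        linarith
      rw [psi1, norm_mul, norm_mul, norm_mul, norm_mul, norm_neg, norm_psi, Complex.norm_real,
        Complex.norm_real, Real.norm_of_nonneg ha.le, Real.norm_of_nonneg hp1.le, hw, Real.rpow_one]
      calc _ ≤ r * (‖w‖ * a * r ^ (a - 1) * Real.exp (-T * r ^ a)) := by gcongr
        _ = ‖w‖ * a * ((r * r ^ (a - 1)) * Real.exp (-T * r ^ a)) := by ring
        _ = _ := by rw [← e1]
    · simpa using (hz 1).const_mul (‖w‖ * a)
  have hint : IntegrableOn (fun r : ℝ => ((r : ℂ) - s) * psi2 a w r) (Ioi s) := by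
    refine Integrable.mono' ((Bd_integrable a T ha hT).mono_set (Ioi_subset_Ioi hs.le)) ?_ ?_
    · have := psi2_meas a w
      exact Measurable.aestronglyMeasurable (by fun_prop)
    · refine (ae_restrict_iff' measurableSet_Ioi).2 (Eventually.of_forall fun r hr => ?_)
      have hr : s < r := hr
      have h3 : ‖(r : ℂ) - s‖ ≤ r := by
        rw [← Complex.ofReal_sub, Complex.norm_real, Real.norm_of_nonneg (by linarith)]
        linarith
      rw [norm_mul]
      refine le_trans ?_ (psi2_bound a T w r (hs.trans hr) ha ha1 hw hT hw2)
      gcongr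
  rw [← e1, e2, integral_Ioi_of_hasDerivAt_of_tendsto'
    (f := fun r : ℝ => ((r : ℂ) - s) * psi1 a w r - psi a w r) (m := 0 - 0) ?_ hint
    (hpsi1.sub hpsi0)]
  · simp
  · intro r hr
    have hr : 0 < r := hs.trans_le hr
    convert! (((hid r).sub_const (s : ℂ)).mul (psi1_deriv a w r hr)).sub (psi_deriv a w r hr) using 1
    simp

lemma Pop_bound (a γ : ℝ) (ha : 0 < a) (ha1 : a ≤ 1) (hγ1 : γ ≤ 1)
    (f : ℝ → ℂ) (hf : Integrable f volume) (A x t : ℝ) (hA : 0 < A) (ht : 0 < t) (ht1 : t < 1)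
    (h : ∀ ρ : ℝ, 0 < ρ → ∫⁻ y in Metric.closedBall x ρ, ‖f y‖ₑ ≤ ENNReal.ofReal (A * ρ)) :
    ‖Pop a γ (ftransform f) t x‖ ≤ 192 * A := by
  set T := t ^ γ with hTdef
  have hT : 0 < T := Real.rpow_pos_of_pos ht _
  have htT : t ≤ T := by
    have := Real.rpow_le_rpow_of_exponent_ge ht ht1.le hγ1
    rwa [Real.rpow_one] at this
  set w : ℂ := (T : ℂ) - Complex.I * (t : ℂ) with hwdef
  have hw : w.re = T := by simp [hwdef]
  have hw2 : ‖w‖ ≤ 2 * T := by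
    refine (norm_sub_le _ _).trans ?_
    rw [norm_mul, Complex.norm_I, Complex.norm_real, Complex.norm_real,
      Real.norm_of_nonneg hT.le, Real.norm_of_nonneg ht.le]
    linarith
  have hmeas := psi2_meas a w
  have hfc := ftransform_cont f hf
  have e1 : Pop a γ (ftransform f) t x = ∫ ξ : ℝ, ∫ r in Ioi 0,
      (ftransform f ξ * ((max (r - |ξ|) 0 : ℝ) : ℂ) *
      Complex.exp (Complex.I * ((x * ξ : ℝ) : ℂ))) * psi2 a w r := by
    unfold Pop
    refine integral_congr_ae ?_
    have hne : ∀ᵐ ξ : ℝ, ξ ≠ 0 := by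
      simp [ae_iff, measure_singleton]
    filter_upwards [hne] with ξ hξ
    have h1 := psi_rep a T w ha ha1 hw hT hw2 |ξ| (abs_pos.2 hξ)
    have h2 : Complex.exp (Complex.I * ((t * |ξ| ^ a : ℝ) : ℂ) - ((t ^ γ * |ξ| ^ a : ℝ) : ℂ)) =
        psi a w |ξ| := by
      rw [psi, hwdef, ← hTdef]; congr 1; push_cast; ring
    rw [h2, ← h1, mul_right_comm, ← integral_const_mul]
    congr 1; ext r; ring
  have hFub : Integrable (Function.uncurry fun ξ r : ℝ =>
      (ftransform f ξ * ((max (r - |ξ|) 0 : ℝ) : ℂ) *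
      Complex.exp (Complex.I * ((x * ξ : ℝ) : ℂ))) * psi2 a w r)
      (volume.prod (volume.restrict (Ioi 0))) := by
    have hdom : Integrable (fun p : ℝ × ℝ => ((∫ y, ‖f y‖) * (1 + p.1 ^ 2)⁻¹) *
        ((1 + p.2 ^ 2) * Bd a T p.2)) (volume.prod (volume.restrict (Ioi 0))) :=
      (integrable_inv_one_add_sq.const_mul _).mul_prod (Bd_integrable2 a T ha hT)
    refine hdom.mono' ?_ ?_
    · have hfm := hfc.measurable
      refine Measurable.aestronglyMeasurable ?_
      unfold Function.uncurry
      fun_prop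
    · have hpos : ∀ᵐ p : ℝ × ℝ ∂(volume.prod (volume.restrict (Ioi 0))), 0 < p.2 :=
        Measure.quasiMeasurePreserving_snd.ae (ae_restrict_mem measurableSet_Ioi)
      filter_upwards [hpos] with p hp
      obtain ⟨ξ, r⟩ := p
      have hp : 0 < r := hp
      have h0 : 0 ≤ ∫ y, ‖f y‖ := integral_nonneg fun _ => norm_nonneg _
      have hb := psi2_bound a T w r hp ha ha1 hw hT hw2
      have hB0 : 0 ≤ Bd a T r := le_trans (by positivity) hb
      simp only [Function.uncurry]
      rw [norm_mul, norm_mul, norm_mul, norm_expI, mul_one, Complex.norm_real,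
        Real.norm_of_nonneg (le_max_right _ _)]
      have h5 : max (r - |ξ|) 0 ≤ (1 + ξ ^ 2)⁻¹ * (1 + r ^ 2) * r := by
        by_cases hc : |ξ| ≤ r
        · rw [max_eq_left (by linarith)]
          have h6 : ξ ^ 2 ≤ r ^ 2 := sq_le_sq' (by linarith [neg_abs_le ξ]) (by linarith [le_abs_self ξ])
          have h7 : 1 ≤ (1 + ξ ^ 2)⁻¹ * (1 + r ^ 2) := by
            rw [inv_mul_eq_div, one_le_div (by positivity)]; linarith
          nlinarith [abs_nonneg ξ]
        · rw [max_eq_right (by linarith)]; positivity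
      calc _ ≤ (∫ y, ‖f y‖) * ((1 + ξ ^ 2)⁻¹ * (1 + r ^ 2) * r) * ‖psi2 a w r‖ := by
            gcongr; exact ftransform_le f ξ
        _ = (∫ y, ‖f y‖) * (1 + ξ ^ 2)⁻¹ * ((1 + r ^ 2) * (r * ‖psi2 a w r‖)) := by ring
        _ ≤ _ := by gcongr
  rw [e1, integral_integral_swap hFub]
  calc _ ≤ ∫ r in Ioi 0, 32 * A * Bd a T r := by
        refine norm_integral_le_of_norm_le ((Bd_integrable a T ha hT).const_mul _) ?_
        refine (ae_restrict_iff' measurableSet_Ioi).2 (Eventually.of_forall fun r hr => ?_)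
        have hr : 0 < r := hr
        rw [integral_mul_const, norm_mul]
        calc _ ≤ 32 * A * r * ‖psi2 a w r‖ := by
              gcongr; exact fejer_mean_bound f hf A r x hA hr h
          _ = 32 * A * (r * ‖psi2 a w r‖) := by ring
          _ ≤ _ := by gcongr; exact psi2_bound a T w r hr ha ha1 hw hT hw2
    _ = 32 * A * ∫ r in Ioi 0, Bd a T r := integral_const_mul _ _
    _ ≤ 32 * A * 6 := by gcongr; exact Bd_integral a T ha ha1 hT
    _ = _ := by ring

theorem maximal_weak_L1_bound (a γ : ℝ) (ha : 0 < a) (ha1 : a ≤ 1)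
    (hγ : 0 < γ) (hγ1 : γ ≤ 1) :
    ∃ C : ℝ, 0 < C ∧ ∀ f : ℝ → ℂ, Integrable f volume → ∀ lam : ℝ, 0 < lam →
      volume {x : ℝ | lam < Pstar a γ (ftransform f) x} ≤
        ENNReal.ofReal (C / lam) * eLpNorm f 1 volume := by
  refine ⟨1920, by norm_num, fun f hf lam hlam => ?_⟩
  have hA : 0 < lam / 192 := by positivity
  have h := hl_weak f hf (lam / 192) hA
  rw [eLpNorm_one_eq_lintegral_enorm]
  have e : 10 / (lam / 192) = 1920 / lam := by field_simp; norm_num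
  rw [e] at h
  refine le_trans (measure_mono ?_) h
  intro x hx
  by_contra hc
  have hc' : ∀ ρ : ℝ, 0 < ρ →
      ∫⁻ y in Metric.closedBall x ρ, ‖f y‖ₑ ≤ ENNReal.ofReal (lam / 192 * ρ) := by
    intro ρ hρ
    by_contra hcc
    exact hc ⟨ρ, hρ, not_le.1 hcc⟩
  have hx : lam < Pstar a γ (ftransform f) x := hx
  have : Nonempty (Set.Ioo (0 : ℝ) 1) := ⟨⟨1 / 2, by norm_num, by norm_num⟩⟩
  have hle : Pstar a γ (ftransform f) x ≤ lam := by
    refine ciSup_le fun t => ?_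
    have := Pop_bound a γ ha ha1 hγ1 f hf (lam / 192) x t hA t.2.1 t.2.2 hc'
    linarith
  linarith
end
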